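/- For j = 1,…,K let γ_{J_j} := min_{ℓ∉J_j} |θ_j − λ_ℓ|, and assume max_{1≤j≤K} ‖𝓗̂−𝓗‖_op / γ_{J_j} < 1/4. For each j, let μ^{(j)} ∈ ℝ^{|J_j|} be the vector of eigenvalues, arranged in non-increasing order, of the symmetric matrix (⟨(𝓗̂−𝓗)ψ_k, ψ_ℓ⟩)_{k,ℓ∈J_j}, and let μ ∈ ℝ^{|J|} be the concatenation of μ^{(1)},…,μ^{(K)} (matching the enumeration of J by increasing index). Then the Euclidean norm of the vector (λ̂_k − λ_k)_{k∈J} − μ is at most sqrt( Σ_{j=1}^K (|J_j| · (11·γ_{J_j} + 32·θ_j)² / 4) · (‖𝓗̂−𝓗‖_op / γ_{J_j})⁴ ). -/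

import Mathlib

open scoped InnerProductSpace Classical
open Filter

noncomputable section

/-- The rank-one operator `u ⊗ v : w ↦ ⟨v, w⟩ u` on a real inner product space. -/
def rankOne {H : Type*} [NormedAddCommGroup H] [InnerProductSpace ℝ H] (u v : H) :
    H →L[ℝ] H :=
  (innerSL ℝ v).smulRight u

/-- Vector of eigenvalues of a real symmetric matrix, in non-increasing order
(junk value `0` if the matrix is not symmetric). -/
def specDesc {m : ℕ} (M : Matrix (Fin m) (Fin m) ℝ) : Fin m → ℝ :=
  if hM : M.IsHermitian then
    fun i => (hM.eigenvalues ∘ Tuple.sort hM.eigenvalues) i.rev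
  else 0

section helpers
variable {H : Type*} [NormedAddCommGroup H] [InnerProductSpace ℝ H]

theorem aux_hasSum_inner {A : H →L[ℝ] H} {lam : ℕ → ℝ} {psi : ℕ → H}
    (hsum : HasSum (fun k => lam k • rankOne (psi k) (psi k)) A) (x : H) :
    HasSum (fun k => lam k * ⟪psi k, x⟫_ℝ ^ 2) ⟪A x, x⟫_ℝ := by
  have h1 : HasSum (fun k => (lam k • rankOne (psi k) (psi k)) x) (A x) :=
    hsum.mapL (ContinuousLinearMap.apply ℝ H x)
  have h2 := h1.mapL (innerSL ℝ x)
  simp only [innerSL_apply_apply] at h2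
  rw [real_inner_comm]
  have h3 : (fun k => lam k * ⟪psi k, x⟫_ℝ ^ 2)
      = fun k => ⟪x, (lam k • rankOne (psi k) (psi k)) x⟫_ℝ := by
    funext k
    have h4 : (lam k • rankOne (psi k) (psi k)) x = lam k • (⟪psi k, x⟫_ℝ • psi k) := rfl
    rw [h4, inner_smul_right, inner_smul_right, real_inner_comm (psi k) x]
    ring
  rw [h3]
  exact h2

theorem aux_eig {A : H →L[ℝ] H} {lam : ℕ → ℝ} {psi : ℕ → H} (hpsi : Orthonormal ℝ psi)
    (hsum : HasSum (fun k => lam k • rankOne (psi k) (psi k)) A) (n : ℕ) :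
    A (psi n) = lam n • psi n := by
  have h1 : HasSum (fun k => (lam k • rankOne (psi k) (psi k)) (psi n)) (A (psi n)) :=
    hsum.mapL (ContinuousLinearMap.apply ℝ H (psi n))
  have h2 : HasSum (fun k => (lam k • rankOne (psi k) (psi k)) (psi n)) (lam n • psi n) := by
    convert hasSum_single n ?_ using 1
    · have := orthonormal_iff_ite.mp hpsi n n
      simp [rankOne, hpsi.1 n]
    · intro k hk
      simp [rankOne, hpsi.2 hk]
  exact h1.unique h2

theorem aux_tail {A : H →L[ℝ] H} {lam : ℕ → ℝ} {psi : ℕ → H} (hpsi : Orthonormal ℝ psi)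
    (hanti : Antitone lam) (hnn : ∀ k, 0 ≤ lam k)
    (hsum : HasSum (fun k => lam k • rankOne (psi k) (psi k)) A) (n : ℕ) (x : H)
    (hx : ∀ k < n, ⟪psi k, x⟫_ℝ = 0) : ⟪A x, x⟫_ℝ ≤ lam n * ‖x‖ ^ 2 := by
  have h := aux_hasSum_inner hsum x
  refine hasSum_le_of_sum_le h fun s => ?_
  calc ∑ k ∈ s, lam k * ⟪psi k, x⟫_ℝ ^ 2 ≤ ∑ k ∈ s, lam n * ⟪psi k, x⟫_ℝ ^ 2 := by
        refine Finset.sum_le_sum fun k _ => ?_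
        by_cases hk : k < n
        · simp [hx k hk]
        · exact mul_le_mul_of_nonneg_right (hanti (not_lt.mp hk)) (sq_nonneg _)
    _ = lam n * ∑ k ∈ s, ⟪psi k, x⟫_ℝ ^ 2 := by rw [Finset.mul_sum]
    _ ≤ lam n * ‖x‖ ^ 2 := by
        refine mul_le_mul_of_nonneg_left ?_ (hnn n)
        simpa using hpsi.sum_inner_products_le x (s := s)

theorem aux_dim (f g : ℕ → H) (n : ℕ) : ∃ c : ℕ → ℝ, (∃ k ∈ Finset.range (n + 1), c k ≠ 0) ∧
    ∀ j < n, ⟪g j, ∑ k ∈ Finset.range (n + 1), c k • f k⟫_ℝ = 0 := by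
  let F : (Fin (n + 1) → ℝ) →ₗ[ℝ] (Fin n → ℝ) :=
    { toFun := fun c j => ⟪g j, ∑ k, c k • f k⟫_ℝ
      map_add' := by
        intro c d; ext j; simp [add_smul, Finset.sum_add_distrib, inner_add_right]
      map_smul' := by
        intro c d; ext j
        simp [mul_smul, ← Finset.smul_sum, inner_smul_right] }
  have hF : LinearMap.ker F ≠ ⊥ := LinearMap.ker_ne_bot_of_finrank_lt (by simp)
  obtain ⟨c, hc, hc0⟩ := (Submodule.ne_bot_iff _).mp hF
  obtain ⟨i, hi⟩ := Function.ne_iff.mp hc0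
  refine ⟨fun k => if h : k < n + 1 then c ⟨k, h⟩ else 0, ⟨i, by simpa using i.is_le, ?_⟩, ?_⟩
  · simpa [i.is_le] using hi
  · intro j hj
    have := congrFun (LinearMap.mem_ker.mp hc) ⟨j, hj⟩
    rw [Finset.sum_range]
    simpa [F, Fin.is_le] using this

theorem aux_norm_sum {f : ℕ → H} (hf : Orthonormal ℝ f) (c : ℕ → ℝ) (s : Finset ℕ) :
    ‖∑ k ∈ s, c k • f k‖ ^ 2 = ∑ k ∈ s, c k ^ 2 := by
  rw [← real_inner_self_eq_norm_sq, hf.inner_sum]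
  simp [pow_two]

theorem aux_quad {f : ℕ → H} (T : H →L[ℝ] H) (c d : ℕ → ℝ) (s : Finset ℕ)
    (hT : ∀ k ∈ s, ∀ l ∈ s, ⟪T (f k), f l⟫_ℝ = if k = l then d k else 0) :
    ⟪T (∑ k ∈ s, c k • f k), ∑ k ∈ s, c k • f k⟫_ℝ = ∑ k ∈ s, d k * c k ^ 2 := by
  rw [map_sum, sum_inner]
  refine Finset.sum_congr rfl fun k hk => ?_
  rw [inner_sum, Finset.sum_eq_single k]
  · simp [inner_smul_left, inner_smul_right, hT k hk k hk]; ring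
  · intro l hl hlk
    simp [inner_smul_left, inner_smul_right, hT k hk l hl, hlk.symm]
  · simp [hk]

theorem aux_abs (T : H →L[ℝ] H) (x y : H) : |⟪T x, y⟫_ℝ| ≤ ‖T‖ * ‖x‖ * ‖y‖ :=
  (abs_real_inner_le_norm _ _).trans (mul_le_mul_of_nonneg_right (T.le_opNorm x) (norm_nonneg _))

theorem aux_expand (T : H →L[ℝ] H) (hT : ∀ x y, ⟪T x, y⟫_ℝ = ⟪x, T y⟫_ℝ) (p q : H) :
    ⟪T (p + q), p + q⟫_ℝ = ⟪T p, p⟫_ℝ + ⟪T q, q⟫_ℝ + 2 * ⟪T p, q⟫_ℝ := by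
  rw [map_add, inner_add_left, inner_add_right, inner_add_right, hT q p, real_inner_comm (T p) q]
  ring

/-- numeric inequality `2εPQ ≤ 4ε²/γ P² + γ/4 Q²` -/
theorem aux_num {e g P Q : ℝ} (hg : 0 < g) :
    2 * (e * P * Q) ≤ 4 * e ^ 2 / g * P ^ 2 + g / 4 * Q ^ 2 := by
  have : 0 ≤ (4 * e * P - g * Q) ^ 2 / (4 * g) := by positivity
  have h2 : (4 * e * P - g * Q) ^ 2 / (4 * g)
      = 4 * e ^ 2 / g * P ^ 2 + g / 4 * Q ^ 2 - 2 * (e * P * Q) := by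
    field_simp; ring
  linarith

theorem aux_core {A Ahat : H →L[ℝ] H} {lam lamhat mu : ℕ → ℝ} {phi psihat : ℕ → H}
    (hAsa : ∀ x y, ⟪A x, y⟫_ℝ = ⟪x, A y⟫_ℝ) (hEsa : ∀ x y, ⟪(Ahat - A) x, y⟫_ℝ = ⟪x, (Ahat - A) y⟫_ℝ)
    (hphi : Orthonormal ℝ phi) (hpsihat : Orthonormal ℝ psihat)
    (hantihat : Antitone lamhat) (hnnhat : ∀ k, 0 ≤ lamhat k)
    (hsumhat : HasSum (fun k => lamhat k • rankOne (psihat k) (psihat k)) Ahat)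
    {th g : ℝ} {a b : ℕ} (hg : 0 < g) (heg : ‖Ahat - A‖ ≤ g / 4)
    (hAphi : ∀ k < b, A (phi k) = lam k • phi k)
    (h1 : ∀ k < a, th + g ≤ lam k) (h2 : ∀ k, a ≤ k → k < b → lam k = th)
    (h3 : ∀ q, (∀ k < b, ⟪phi k, q⟫_ℝ = 0) → ⟪A q, q⟫_ℝ ≤ (th - g) * ‖q‖ ^ 2)
    (hE : ∀ k ∈ Finset.Ico a b, ∀ l ∈ Finset.Ico a b,
      ⟪(Ahat - A) (phi k), phi l⟫_ℝ = if k = l then mu k else 0)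
    (hmu : ∀ k l, a ≤ k → k ≤ l → l < b → mu l ≤ mu k)
    (n : ℕ) (han : a ≤ n) (hnb : n < b) :
    |lamhat n - th - mu n| ≤ 4 * ‖Ahat - A‖ ^ 2 / g := by
  set E := Ahat - A with hEdef
  have hAhat : ∀ x, ⟪Ahat x, x⟫_ℝ = ⟪A x, x⟫_ℝ + ⟪E x, x⟫_ℝ := by
    intro x; rw [← inner_add_left]; simp [hEdef]
  have hmun : |mu n| ≤ ‖E‖ := by
    have hn : n ∈ Finset.Ico a b := by simp [han, hnb]
    have := hE n hn n hn
    rw [if_pos rfl] at this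
    rw [← this]
    simpa [hphi.1 n] using aux_abs E (phi n) (phi n)
  obtain ⟨hmu1, hmu2⟩ := abs_le.mp hmun
  have he0 : 0 ≤ ‖E‖ := norm_nonneg _
  have hC : 4 * ‖E‖ ^ 2 / g ≤ g / 4 := by
    rw [div_le_iff₀ hg]; nlinarith
  have hC0 : 0 ≤ 4 * ‖E‖ ^ 2 / g := by positivity
  have hAB : ∀ k ∈ Finset.range b, ∀ l ∈ Finset.range b,
      ⟪A (phi k), phi l⟫_ℝ = if k = l then lam k else 0 := by
    intro k hk l _
    rw [hAphi k (by simpa using hk), inner_smul_left, orthonormal_iff_ite.mp hphi]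
    simp
  rw [abs_le]
  constructor
  · -- lower bound
    obtain ⟨c, ⟨k0, hk0, hck0⟩, hc⟩ := aux_dim phi psihat n
    set x := ∑ k ∈ Finset.range (n + 1), c k • phi k with hx
    have hup := aux_tail hpsihat hantihat hnnhat hsumhat n x hc
    set p := ∑ k ∈ Finset.Ico a (n + 1), c k • phi k with hp
    set q := ∑ k ∈ Finset.range a, c k • phi k with hq
    have hxpq : x = p + q := by
      rw [hx, hp, hq, add_comm (∑ k ∈ Finset.Ico a (n + 1), c k • phi k),
        Finset.sum_range_add_sum_Ico _ (by omega)]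
    have hnx : ‖x‖ ^ 2 = ‖p‖ ^ 2 + ‖q‖ ^ 2 := by
      rw [hx, hp, hq, aux_norm_sum hphi, aux_norm_sum hphi, aux_norm_sum hphi, 
        add_comm (∑ k ∈ Finset.Ico a (n + 1), c k ^ 2), Finset.sum_range_add_sum_Ico _ (by omega)]
    have hxpos : 0 < ‖x‖ ^ 2 := by
      rw [hx, aux_norm_sum hphi]
      exact Finset.sum_pos' (fun _ _ => sq_nonneg _) ⟨k0, hk0, by positivity⟩
    have hA : (th + g) * ‖q‖ ^ 2 + th * ‖p‖ ^ 2 ≤ ⟪A x, x⟫_ℝ := by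
      rw [hx, aux_quad A c lam, ← Finset.sum_range_add_sum_Ico _ (show a ≤ n + 1 by omega), hp, hq,
        aux_norm_sum hphi, aux_norm_sum hphi, Finset.mul_sum, Finset.mul_sum]
      · refine add_le_add (Finset.sum_le_sum fun k hk => ?_) (Finset.sum_le_sum fun k hk => ?_)
        · exact mul_le_mul_of_nonneg_right (h1 k (by simpa using hk)) (sq_nonneg _)
        · simp only [Finset.mem_Ico] at hk
          rw [h2 k hk.1 (by omega)]
      · intro k hk l hl
        simp only [Finset.mem_range] at hk hl
        exact hAB k (by simp; omega) l (by simp; omega)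
    have hEp : mu n * ‖p‖ ^ 2 ≤ ⟪E p, p⟫_ℝ := by
      rw [hp, aux_quad E c mu, aux_norm_sum hphi, Finset.mul_sum]
      · refine Finset.sum_le_sum fun k hk => ?_
        simp only [Finset.mem_Ico] at hk
        exact mul_le_mul_of_nonneg_right (hmu k n hk.1 (by omega) hnb) (sq_nonneg _)
      · intro k hk l hl
        simp only [Finset.mem_Ico] at hk hl
        exact hE k (by simp; omega) l (by simp; omega)
    have hEx := aux_expand E hEsa p q
    rw [← hxpq] at hEx
    have hEq := (abs_le.mp (aux_abs E q q)).1
    have hEpq := (abs_le.mp (aux_abs E p q)).1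
    have hnum := aux_num (e := ‖E‖) (P := ‖p‖) (Q := ‖q‖) hg
    rw [hAhat x, hnx] at hup
    rw [hnx] at hxpos
    set C := 4 * ‖E‖ ^ 2 / g
    by_contra hcon
    push Not at hcon
    have k1 : lamhat n * (‖p‖ ^ 2 + ‖q‖ ^ 2) < (th + mu n - C) * (‖p‖ ^ 2 + ‖q‖ ^ 2) :=
      mul_lt_mul_of_pos_right (by linarith) hxpos
    have k2 : 0 ≤ (g - ‖E‖ - g / 4 - mu n + C) * ‖q‖ ^ 2 :=
      mul_nonneg (by linarith) (sq_nonneg _)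
    nlinarith
  · -- upper bound
    obtain ⟨c, ⟨k0, hk0, hck0⟩, hc⟩ := aux_dim psihat phi n
    set x := ∑ k ∈ Finset.range (n + 1), c k • psihat k with hx
    have hxpos : 0 < ‖x‖ ^ 2 := by
      rw [hx, aux_norm_sum hpsihat]
      exact Finset.sum_pos' (fun _ _ => sq_nonneg _) ⟨k0, hk0, by positivity⟩
    have hlow : lamhat n * ‖x‖ ^ 2 ≤ ⟪Ahat x, x⟫_ℝ := by
      rw [hx, aux_quad Ahat c lamhat, aux_norm_sum hpsihat, Finset.mul_sum]
      · refine Finset.sum_le_sum fun k hk => ?_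
        simp only [Finset.mem_range] at hk
        exact mul_le_mul_of_nonneg_right (hantihat (by omega)) (sq_nonneg _)
      · intro k hk l hl
        rw [aux_eig hpsihat hsumhat, inner_smul_left, orthonormal_iff_ite.mp hpsihat]
        simp
    set d : ℕ → ℝ := fun k => ⟪phi k, x⟫_ℝ with hd
    set p := ∑ k ∈ Finset.Ico n b, d k • phi k with hp
    set q := x - p with hq
    have hxpq : x = p + q := by simp [hq]
    have hqo : ∀ k < b, ⟪phi k, q⟫_ℝ = 0 := by
      intro k hk
      rw [hq, inner_sub_right, hp]
      by_cases hkn : k < n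
      · rw [hc k hkn, inner_sum, Finset.sum_eq_zero, sub_zero]
        intro l hl
        simp only [Finset.mem_Ico] at hl
        rw [inner_smul_right, hphi.2 (show k ≠ l by omega), mul_zero]
      · rw [hphi.inner_right_sum d (by simp; omega)]
        exact sub_self _
    have hpq : ⟪p, q⟫_ℝ = 0 := by
      rw [hp, sum_inner]
      refine Finset.sum_eq_zero fun k hk => ?_
      simp only [Finset.mem_Ico] at hk
      rw [inner_smul_left, hqo k hk.2, mul_zero]
    have hnx : ‖x‖ ^ 2 = ‖p‖ ^ 2 + ‖q‖ ^ 2 := by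
      rw [hxpq, @norm_add_sq_real, hpq]; ring
    have hAp : A p = th • p := by
      rw [hp, map_sum, Finset.smul_sum]
      refine Finset.sum_congr rfl fun k hk => ?_
      simp only [Finset.mem_Ico] at hk
      rw [map_smul, hAphi k hk.2, h2 k (by omega) hk.2, smul_comm]
    have hAx := aux_expand A hAsa p q
    rw [← hxpq, hAp, inner_smul_left, inner_smul_left, hpq, real_inner_self_eq_norm_sq] at hAx
    simp only [conj_trivial, mul_zero, add_zero] at hAx
    have hEp : ⟪E p, p⟫_ℝ ≤ mu n * ‖p‖ ^ 2 := by
      rw [hp, aux_quad E d mu, aux_norm_sum hphi, Finset.mul_sum]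
      · refine Finset.sum_le_sum fun k hk => ?_
        simp only [Finset.mem_Ico] at hk
        exact mul_le_mul_of_nonneg_right (hmu n k han hk.1 hk.2) (sq_nonneg _)
      · intro k hk l hl
        simp only [Finset.mem_Ico] at hk hl
        exact hE k (by simp; omega) l (by simp; omega)
    have hAq := h3 q hqo
    have hEx := aux_expand E hEsa p q
    rw [← hxpq] at hEx
    have hEq := (abs_le.mp (aux_abs E q q)).2
    have hEpq := (abs_le.mp (aux_abs E p q)).2
    have hnum := aux_num (e := ‖E‖) (P := ‖p‖) (Q := ‖q‖) hg
    rw [hAhat x, hnx] at hlow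
    rw [hnx] at hxpos
    set C := 4 * ‖E‖ ^ 2 / g
    by_contra hcon
    push Not at hcon
    have k1 : (th + mu n + C) * (‖p‖ ^ 2 + ‖q‖ ^ 2) < lamhat n * (‖p‖ ^ 2 + ‖q‖ ^ 2) :=
      mul_lt_mul_of_pos_right (by linarith) hxpos
    have k2 : 0 ≤ (g - ‖E‖ - g / 4 + mu n + C) * ‖q‖ ^ 2 :=
      mul_nonneg (by linarith) (sq_nonneg _)
    nlinarith

end helpers

section helpers2
variable {H : Type*} [NormedAddCommGroup H] [InnerProductSpace ℝ H]

theorem aux_block {A Ahat : H →L[ℝ] H} {lam lamhat : ℕ → ℝ} {psi psihat : ℕ → H}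
    (hAsa : ∀ x y, ⟪A x, y⟫_ℝ = ⟪x, A y⟫_ℝ) (hEsa : ∀ x y, ⟪(Ahat - A) x, y⟫_ℝ = ⟪x, (Ahat - A) y⟫_ℝ)
    (hpsi : Orthonormal ℝ psi) (hpsihat : Orthonormal ℝ psihat)
    (hanti : Antitone lam) (hantihat : Antitone lamhat)
    (hnn : ∀ k, 0 ≤ lam k) (hnnhat : ∀ k, 0 ≤ lamhat k)
    (hsum : HasSum (fun k => lam k • rankOne (psi k) (psi k)) A)
    (hsumhat : HasSum (fun k => lamhat k • rankOne (psihat k) (psihat k)) Ahat)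
    {th g : ℝ} {a m : ℕ} (hg : 0 < g) (heg : ‖Ahat - A‖ ≤ g / 4)
    (h1 : ∀ k < a, th + g ≤ lam k) (h2 : ∀ i : Fin m, lam (a + i) = th)
    (h3 : lam (a + m) ≤ th - g)
    (M : Matrix (Fin m) (Fin m) ℝ)
    (hM : ∀ i j, M i j = ⟪(Ahat - A) (psi (a + i)), psi (a + j)⟫_ℝ) (i : Fin m) :
    |lamhat (a + i) - th - specDesc M i| ≤ 4 * ‖Ahat - A‖ ^ 2 / g := by
  have hH : M.IsHermitian := by
    ext i j
    rw [Matrix.conjTranspose_apply, hM, hM, star_trivial, hEsa, real_inner_comm]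
  set s : Fin m → ℝ := specDesc M with hs
  let σ : Fin m → Fin m := fun i => Tuple.sort hH.eigenvalues i.rev
  have hσ : Function.Injective σ :=
    (Tuple.sort hH.eigenvalues).injective.comp Fin.rev_injective
  have hσs : Function.Surjective σ := Finite.surjective_of_injective hσ
  have hsσ : ∀ i, s i = hH.eigenvalues (σ i) := by
    intro i; simp only [hs, specDesc, dif_pos hH, σ, Function.comp]
  have hsanti : ∀ i j : Fin m, i ≤ j → s j ≤ s i := by
    intro i j hij
    rw [hsσ, hsσ]
    exact Tuple.monotone_sort hH.eigenvalues (Fin.rev_le_rev.mpr hij)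
  let u : Fin m → Fin m → ℝ := fun i b => hH.eigenvectorBasis (σ i) b
  have huu : ∀ i j, ∑ b, u i b * u j b = if i = j then 1 else 0 := by
    intro i j
    have := orthonormal_iff_ite.mp hH.eigenvectorBasis.orthonormal (σ i) (σ j)
    simp only [hσ.eq_iff] at this
    rw [← this]
    simp [PiLp.inner_apply, u, mul_comm]
  have huM : ∀ i b, ∑ c, M b c * u i c = s i * u i b := by
    intro i b
    have := congrFun (hH.mulVec_eigenvectorBasis (σ i)) b
    rw [hsσ]
    simpa [Matrix.mulVec, dotProduct, u] using this
  let v : Fin m → H := fun i => ∑ b : Fin m, u i b • psi (a + b)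
  have hpab : ∀ b c : Fin m, ⟪psi (a + b), psi (a + c)⟫_ℝ = if b = c then 1 else 0 := by
    intro b c
    rw [orthonormal_iff_ite.mp hpsi]
    simp [Fin.ext_iff]
  have hvv : ∀ i j, ⟪v i, v j⟫_ℝ = if i = j then 1 else 0 := by
    intro i j
    rw [← huu]
    simp [v, sum_inner, inner_sum, inner_smul_left, inner_smul_right, hpab, mul_comm]
  have hEv : ∀ i j, ⟪(Ahat - A) (v i), v j⟫_ℝ = if i = j then s i else 0 := by
    intro i j
    have e1 : ⟪(Ahat - A) (v i), v j⟫_ℝ = ∑ c, ∑ b, u i b * (u j c * M b c) := by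
      simp only [v, map_sum, map_smul]
      rw [inner_sum]
      refine Finset.sum_congr rfl fun c _ => ?_
      rw [sum_inner]
      refine Finset.sum_congr rfl fun b _ => ?_
      rw [inner_smul_left, inner_smul_right, hM]
      simp
    have e2 : ∀ c, ∑ b, u i b * (u j c * M b c) = s i * (u i c * u j c) := by
      intro c
      have := huM i c
      have hsym : ∀ b, M b c = M c b := fun b => by
        have := congrFun (congrFun hH c) b
        simpa using this
      calc ∑ b, u i b * (u j c * M b c) = u j c * ∑ b, M c b * u i b := by
            rw [Finset.mul_sum]
            exact Finset.sum_congr rfl fun b _ => by rw [hsym b]; ring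
        _ = _ := by rw [this]; ring
    rw [e1, Finset.sum_congr rfl fun c _ => e2 c, ← Finset.mul_sum, huu]
    simp
  have hvpsi : ∀ i k, (k < a ∨ a + m ≤ k) → ⟪psi k, v i⟫_ℝ = 0 := by
    intro i k hk
    simp only [v, inner_sum, inner_smul_right]
    refine Finset.sum_eq_zero fun b _ => ?_
    rw [hpsi.2 (show k ≠ a + b by omega), mul_zero]
  let phi : ℕ → H := fun k => if h : a ≤ k ∧ k < a + m then v ⟨k - a, by omega⟩ else psi k
  let mu : ℕ → ℝ := fun k => if h : a ≤ k ∧ k < a + m then s ⟨k - a, by omega⟩ else 0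
  have hphiv : ∀ i : Fin m, phi (a + i) = v i := by
    intro i; simp [phi]
  have hphip : ∀ k, (k < a ∨ a + m ≤ k) → phi k = psi k := by
    intro k hk
    simp only [phi]
    rw [dif_neg (by omega)]
  have hmus : ∀ i : Fin m, mu (a + i) = s i := by
    intro i; simp [mu]
  have hsplit : ∀ k, (∃ i : Fin m, k = a + i) ∨ (k < a ∨ a + m ≤ k) := by
    intro k
    by_cases h : k < a ∨ a + m ≤ k
    · exact Or.inr h
    · exact Or.inl ⟨⟨k - a, by omega⟩, by simp; omega⟩
  have hphi : Orthonormal ℝ phi := by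
    rw [orthonormal_iff_ite]
    intro k l
    rcases hsplit k with ⟨i, rfl⟩ | hk <;> rcases hsplit l with ⟨j, rfl⟩ | hl
    · rw [hphiv, hphiv, hvv]; simp [Fin.ext_iff]
    · rw [hphiv, hphip l hl, real_inner_comm, hvpsi i l hl, if_neg (by omega)]
    · rw [hphiv, hphip k hk, hvpsi j k hk, if_neg (by omega)]
    · rw [hphip k hk, hphip l hl, orthonormal_iff_ite.mp hpsi]
  have huniv : ∀ b, ∑ i, u i b • v i = psi (a + b) := by
    intro b
    have hcol : ∀ c, ∑ i, u i b * u i c = if b = c then 1 else 0 := by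
      have hU : (Matrix.of u) * (Matrix.of u).transpose = 1 := by
        ext i j
        simp [Matrix.mul_apply, huu, Matrix.one_apply]
      have hU' := mul_eq_one_comm.mp hU
      intro c
      have := congrFun (congrFun hU' b) c
      simpa [Matrix.mul_apply, Matrix.one_apply] using this
    simp only [v, Finset.smul_sum, smul_smul]
    rw [Finset.sum_comm]
    simp only [← Finset.sum_smul, hcol]
    simp
  have hmain := aux_core (mu := mu) (lam := lam) (a := a) (b := a + m) (th := th) hAsa hEsa hphi hpsihat
    hantihat hnnhat hsumhat hg heg ?_ h1 ?_ ?_ ?_ ?_ (a + i) (by omega) (by omega)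
  · rw [hmus] at hmain; exact hmain
  · intro k _
    rcases hsplit k with ⟨i, rfl⟩ | hk
    · rw [hphiv, h2]
      simp only [v, map_sum, map_smul, Finset.smul_sum]
      refine Finset.sum_congr rfl fun b _ => ?_
      rw [aux_eig hpsi hsum, h2, smul_comm]
    · rw [hphip k hk, aux_eig hpsi hsum]
  · intro k hk hk'
    rcases hsplit k with ⟨i, rfl⟩ | hk
    · exact h2 i
    · omega
  · intro q hq
    refine (aux_tail hpsi hanti hnn hsum (a + m) q ?_).trans
      (mul_le_mul_of_nonneg_right h3 (sq_nonneg _))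
    intro k hk
    rcases hsplit k with ⟨b, rfl⟩ | hk'
    · rw [← huniv, sum_inner]
      refine Finset.sum_eq_zero fun i _ => ?_
      rw [inner_smul_left, ← hphiv, hq _ (by omega), mul_zero]
    · rw [← hphip k hk', hq k hk]
  · intro k hk l hl
    rw [Finset.mem_Ico] at hk hl
    rcases hsplit k with ⟨i, rfl⟩ | hk'
    · rcases hsplit l with ⟨j, rfl⟩ | hl'
      · rw [hphiv, hphiv, hEv, hmus]; simp [Fin.ext_iff]
      · omega
    · omega
  · intro k l hk hkl hl
    rcases hsplit k with ⟨i, rfl⟩ | hk'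
    · rcases hsplit l with ⟨j, rfl⟩ | hl'
      · rw [hmus, hmus]; exact hsanti i j (by rw [Fin.le_def]; omega)
      · omega
    · omega

theorem aux_interval (S : Finset ℕ) (hS : S.Nonempty)
    (hc : ∀ x ∈ S, ∀ z ∈ S, ∀ y, x ≤ y → y ≤ z → y ∈ S) :
    ∃ a, S = Finset.Ico a (a + S.card) ∧ ∀ i, (S.orderIsoOfFin rfl i).1 = a + i := by
  have h : S = Finset.Ico (S.min' hS) (S.max' hS + 1) := by
    ext y
    rw [Finset.mem_Ico]
    constructor
    · intro hy; exact ⟨S.min'_le y hy, Nat.lt_succ_of_le (S.le_max' y hy)⟩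
    · rintro ⟨h1, h2⟩
      exact hc _ (S.min'_mem hS) _ (S.max'_mem hS) y h1 (by omega)
  have hle : S.min' hS ≤ S.max' hS := S.min'_le _ (S.max'_mem hS)
  have hcard : S.card = S.max' hS + 1 - S.min' hS := by
    conv_lhs => rw [h]
    simp
  have h' : S = Finset.Ico (S.min' hS) (S.min' hS + S.card) := by
    rw [hcard, Nat.add_sub_cancel' (by omega)]; exact h
  refine ⟨S.min' hS, h', fun i => ?_⟩
  generalize S.min' hS = a at h'
  have := Finset.orderEmbOfFin_unique (s := S) rfl (f := fun i : Fin S.card => a + (i : ℕ)) ?_ ?_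
  · rw [Finset.coe_orderIsoOfFin_apply]
    exact (congrFun this i).symm
  · intro x
    have hx := x.2
    have hmem : a + (x : ℕ) ∈ Finset.Ico a (a + S.card) := by
      rw [Finset.mem_Ico]; omega
    exact (Finset.ext_iff.mp h' _).mpr hmem
  · intro x y hxy
    simpa using hxy

end helpers2

/-- Theorem (well-separated eigenvalues): assuming
`max_j ‖𝓗̂−𝓗‖/γ_{J_j} < 1/4`, the vector `(λ̂_k − λ_k)_{k∈J}` is approximated by the
concatenation `μ` of the sorted spectra of the matrices `(⟨(𝓗̂−𝓗)ψ_k,ψ_ℓ⟩)_{k,ℓ∈J_j}`,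
with Euclidean error at most
`sqrt( Σ_j |J_j| (11γ_{J_j} + 32θ_j)²/4 · (‖𝓗̂−𝓗‖/γ_{J_j})⁴ )`. -/
theorem eigenvalue_expansion_separated
    (H : Type*) [NormedAddCommGroup H] [InnerProductSpace ℝ H] [CompleteSpace H]
    [TopologicalSpace.SeparableSpace H]
    (A Ahat : H →L[ℝ] H)
    (hAcomp : IsCompactOperator A) (hAhatcomp : IsCompactOperator Ahat)
    (hAsa : IsSelfAdjoint A) (hAhatsa : IsSelfAdjoint Ahat)
    (lam lamhat : ℕ → ℝ) (psi psihat : ℕ → H)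
    (hpsi : Orthonormal ℝ psi) (hpsihat : Orthonormal ℝ psihat)
    (hanti : Antitone lam) (hantihat : Antitone lamhat)
    (hnn : ∀ k, 0 ≤ lam k) (hnnhat : ∀ k, 0 ≤ lamhat k)
    (hlim : Tendsto lam atTop (nhds 0)) (hlimhat : Tendsto lamhat atTop (nhds 0))
    (hsum : HasSum (fun k => lam k • rankOne (psi k) (psi k)) A)
    (hsumhat : HasSum (fun k => lamhat k • rankOne (psihat k) (psihat k)) Ahat)
    (J : Finset ℕ)
    (γ : ℝ) (hγ : γ = sInf {d : ℝ | ∃ k ∈ J, ∃ ℓ, ℓ ∉ J ∧ d = |lam k - lam ℓ|})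
    (hγpos : 0 < γ)
    -- the distinct eigenvalues θ_1 > … > θ_K among {λ_k : k ∈ J}
    (K : ℕ) (θ : Fin K → ℝ) (hθanti : StrictAnti θ)
    (hθsurj : ∀ j : Fin K, ∃ k ∈ J, lam k = θ j)
    -- `jmap k` is the index of the cluster of `k ∈ J`
    (jmap : {k // k ∈ J} → Fin K) (hjmap : ∀ k : {k // k ∈ J}, lam k.1 = θ (jmap k))
    -- the clusters `J_j` and the individual spectral gaps `γ_{J_j}`
    (Jj : Fin K → Finset ℕ) (hJj : ∀ j, Jj j = J.filter fun k => lam k = θ j)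
    (γj : Fin K → ℝ)
    (hγj : ∀ j, γj j = sInf {d : ℝ | ∃ ℓ, ℓ ∉ Jj j ∧ d = |θ j - lam ℓ|})
    (hcond : ∀ j : Fin K, ‖Ahat - A‖ / γj j < 1 / 4)
    -- the matrices `(⟨(𝓗̂−𝓗)ψ_k, ψ_ℓ⟩)_{k,ℓ∈J_j}`, ordered by increasing index
    (Mmat : ∀ j : Fin K, Matrix (Fin (Jj j).card) (Fin (Jj j).card) ℝ)
    (hMmat : ∀ j, Mmat j = Matrix.of fun a b =>
      ⟪(Ahat - A) (psi ((Jj j).orderIsoOfFin rfl a).1), psi ((Jj j).orderIsoOfFin rfl b).1⟫_ℝ)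
    -- `μ` is the concatenation of the sorted spectra `spec↓(Mmat j)`, `j = 1,…,K`,
    -- matching the enumeration of `J` by increasing index
    (μ : {k // k ∈ J} → ℝ)
    (hμ : ∀ (k : {k // k ∈ J}) (hk : k.1 ∈ Jj (jmap k)),
      μ k = specDesc (Mmat (jmap k)) (((Jj (jmap k)).orderIsoOfFin rfl).symm ⟨k.1, hk⟩)) :
    Real.sqrt (∑ k ∈ J.attach, ((lamhat k.1 - lam k.1) - μ k) ^ 2)
      ≤ Real.sqrt (∑ j : Fin K,
          (Jj j).card * (11 * γj j + 32 * θ j) ^ 2 / 4 * (‖Ahat - A‖ / γj j) ^ 4) := by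
  have hAs : ∀ x y, ⟪A x, y⟫_ℝ = ⟪x, A y⟫_ℝ := fun x y => hAsa.isSymmetric x y
  have hEs : ∀ x y, ⟪(Ahat - A) x, y⟫_ℝ = ⟪x, (Ahat - A) y⟫_ℝ :=
    fun x y => (hAhatsa.sub hAsa).isSymmetric x y
  have hgap : ∀ k ∈ J, ∀ l, l ∉ J → γ ≤ |lam k - lam l| := by
    intro k hk l hl
    rw [hγ]
    refine csInf_le ⟨0, ?_⟩ ⟨k, hk, l, hl, rfl⟩
    rintro d ⟨_, _, _, _, rfl⟩
    exact abs_nonneg _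
  have hmem : ∀ j l, l ∈ Jj j ↔ lam l = θ j := by
    intro j l
    rw [hJj, Finset.mem_filter]
    refine ⟨fun h => h.2, fun h => ⟨?_, h⟩⟩
    by_contra hl
    obtain ⟨k, hk, hkj⟩ := hθsurj j
    have := hgap k hk l hl
    rw [hkj, h, sub_self, abs_zero] at this
    linarith
  have hgapj : ∀ j l, l ∉ Jj j → γj j ≤ |θ j - lam l| := by
    intro j l hl
    rw [hγj]
    refine csInf_le ⟨0, ?_⟩ ⟨l, hl, rfl⟩
    rintro d ⟨_, _, rfl⟩
    exact abs_nonneg _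
  have hIco : ∀ j, ∃ a, Jj j = Finset.Ico a (a + (Jj j).card) ∧
      ∀ i, ((Jj j).orderIsoOfFin rfl i).1 = a + i := by
    intro j
    obtain ⟨k, hk, hkj⟩ := hθsurj j
    refine aux_interval (Jj j) ⟨k, (hmem j k).mpr hkj⟩ ?_
    intro x hx z hz y hxy hyz
    rw [hmem] at *
    exact le_antisymm (hx ▸ hanti hxy) (hz ▸ hanti hyz)
  have hθ0 : ∀ j, 0 ≤ θ j := by
    intro j
    obtain ⟨k, hk, hkj⟩ := hθsurj j
    exact hkj ▸ hnn k
  have hmemI : ∀ j a, Jj j = Finset.Ico a (a + (Jj j).card) →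
      ∀ l, lam l = θ j ↔ a ≤ l ∧ l < a + (Jj j).card := by
    intro j a ha l
    rw [← hmem, ← Finset.mem_Ico, ← ha]
  have hcardpos : ∀ j, 0 < (Jj j).card := by
    intro j
    obtain ⟨k, hk, hkj⟩ := hθsurj j
    exact Finset.card_pos.mpr ⟨k, (hmem j k).mpr hkj⟩
  have hγjpos : ∀ j, 0 < γj j := by
    intro j
    obtain ⟨a, ha, -⟩ := hIco j
    have hI := hmemI j a ha
    have hm := hcardpos j
    set m := (Jj j).card
    have haθ : lam a = θ j := (hI a).mpr ⟨le_rfl, by omega⟩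
    have hup : lam (a + m) < θ j := by
      refine lt_of_le_of_ne (haθ ▸ hanti (by omega)) fun h => ?_
      have := (hI _).mp h
      omega
    have hlo : ∀ l, l < a → θ j < lam l := by
      intro l hl
      refine lt_of_le_of_ne (haθ ▸ hanti hl.le) fun h => ?_
      have := (hI _).mp h.symm
      omega
    have hδ : 0 < min (θ j - lam (a + m)) (if a = 0 then 1 else lam (a - 1) - θ j) := by
      refine lt_min (by linarith) ?_
      split_ifs with h0
      · exact one_pos
      · have := hlo (a - 1) (by omega)
        linarith
    refine lt_of_lt_of_le hδ ?_
    rw [hγj]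
    refine le_csInf ⟨_, a + m, ?_, rfl⟩ ?_
    · rw [hmem]; exact hup.ne
    · rintro d ⟨l, hl, rfl⟩
      rw [hmem, hI] at hl
      by_cases hla : l < a
      · refine (min_le_right _ _).trans ?_
        rw [if_neg (by omega), abs_sub_comm]
        refine le_trans ?_ (le_abs_self _)
        have := hanti (show l ≤ a - 1 by omega)
        linarith
      · refine (min_le_left _ _).trans (le_trans ?_ (le_abs_self _))
        have := hanti (show a + m ≤ l by omega)
        linarith
  have hpt : ∀ k : {k // k ∈ J}, |lamhat k.1 - lam k.1 - μ k|
      ≤ 4 * ‖Ahat - A‖ ^ 2 / γj (jmap k) := by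
    intro k
    have hk : k.1 ∈ Jj (jmap k) := (hmem _ _).mpr (hjmap k)
    rw [hμ k hk, hjmap k]
    generalize jmap k = j at hk
    obtain ⟨a, ha, hord⟩ := hIco j
    have hI := hmemI j a ha
    have hm := hcardpos j
    obtain ⟨i, hi⟩ : ∃ i, i = ((Jj j).orderIsoOfFin rfl).symm ⟨k.1, hk⟩ := ⟨_, rfl⟩
    have hki : k.1 = a + i := by
      rw [← hord i, hi, OrderIso.apply_symm_apply]
    rw [← hi, hki]
    have haθ : lam a = θ j := (hI a).mpr ⟨le_rfl, by omega⟩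
    refine aux_block hAs hEs hpsi hpsihat hanti hantihat hnn hnnhat hsum hsumhat (hγjpos j)
      ?_ ?_ ?_ ?_ (Mmat j) ?_ i
    · have := (div_lt_iff₀ (hγjpos j)).mp (hcond j)
      linarith
    · intro l hl
      have h1 := hgapj j l (by rw [hmem, hI]; omega)
      have h2 : θ j ≤ lam l := haθ ▸ hanti hl.le
      rw [abs_of_nonpos (by linarith)] at h1
      linarith
    · intro i
      exact (hI _).mpr ⟨by omega, by omega⟩
    · have h1 := hgapj j (a + (Jj j).card) (by rw [hmem, hI]; omega)
      have h2 : lam (a + (Jj j).card) ≤ θ j := haθ ▸ hanti (by omega)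
      rw [abs_of_nonneg (by linarith)] at h1
      linarith
    · intro i i'
      rw [hMmat j, Matrix.of_apply, hord, hord]
  refine Real.sqrt_le_sqrt ?_
  calc ∑ k ∈ J.attach, ((lamhat k.1 - lam k.1) - μ k) ^ 2
      ≤ ∑ k ∈ J.attach, (4 * ‖Ahat - A‖ ^ 2 / γj (jmap k)) ^ 2 := by
        refine Finset.sum_le_sum fun k _ => ?_
        rw [← sq_abs]
        exact pow_le_pow_left₀ (abs_nonneg _) (hpt k) 2
    _ = ∑ j : Fin K, ∑ k ∈ J.attach with jmap k = j, (4 * ‖Ahat - A‖ ^ 2 / γj (jmap k)) ^ 2 :=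
        (Finset.sum_fiberwise _ _ _).symm
    _ ≤ _ := by
        refine Finset.sum_le_sum fun j _ => ?_
        have e1 : ∑ k ∈ J.attach with jmap k = j, (4 * ‖Ahat - A‖ ^ 2 / γj (jmap k)) ^ 2
            = ((J.attach.filter fun k => jmap k = j).card : ℝ) *
              (4 * ‖Ahat - A‖ ^ 2 / γj j) ^ 2 := by
          rw [← nsmul_eq_mul, ← Finset.sum_const]
          refine Finset.sum_congr rfl fun k hk => ?_
          rw [(Finset.mem_filter.mp hk).2]
        have e2 : (J.attach.filter fun k => jmap k = j).card ≤ (Jj j).card := by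
          refine Finset.card_le_card_of_injOn Subtype.val ?_ Subtype.val_injective.injOn
          intro k hk
          have hk' := (Finset.mem_filter.mp hk).2
          exact (hmem j k.1).mpr (hk' ▸ hjmap k)
        have hg := hγjpos j
        have e3 : (4 * ‖Ahat - A‖ ^ 2 / γj j) ^ 2
            ≤ (11 * γj j + 32 * θ j) ^ 2 / 4 * (‖Ahat - A‖ / γj j) ^ 4 := by
          have : (4 * ‖Ahat - A‖ ^ 2 / γj j) ^ 2
              = (8 * γj j) ^ 2 / 4 * (‖Ahat - A‖ / γj j) ^ 4 := by
            field_simp; ring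
          rw [this]
          have h8 : 8 * γj j ≤ 11 * γj j + 32 * θ j := by linarith [hθ0 j]
          gcongr
        rw [e1, mul_div_assoc ((Jj j).card : ℝ), mul_assoc ((Jj j).card : ℝ)]
        exact mul_le_mul (by exact_mod_cast e2) e3 (sq_nonneg _) (Nat.cast_nonneg _)
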